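/- Under the feature-label strategy, if for every collective c the classifier m is ε-suboptimal on X under the mixture P, P_0^X(X_c*) ≤ ξ_c, and P_j^X(X_c*) ≤ ξ for all j ≠ c, then the egalitarian global success satisfies S_min := min_{c∈[M]} S_c(α_c) ≥ 1 − max_{c∈[M]} [ ξ_c · (Δ_c + 2ε)/(1 − 2ε) · (1 − ᾱ)/α_c + ξ · (1 + 2ε)/(1 − 2ε) · (ᾱ − α_c − β_c)/α_c ]. -/

import Mathlib

open Finset

/-- A distribution on a finite set: nonnegative and sums to 1. -/
def IsDist {S : Type*} [Fintype S] (f : S → ℝ) : Prop :=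
  (∀ s, 0 ≤ f s) ∧ ∑ s, f s = 1

/-- X-marginal of a distribution on `X × Y`. -/
noncomputable def margX {X Y : Type*} [Fintype Y] (μ : X × Y → ℝ) (x : X) : ℝ :=
  ∑ y, μ (x, y)

/-- Y-marginal of a distribution on `X × Y`. -/
noncomputable def margY {X Y : Type*} [Fintype X] (μ : X × Y → ℝ) (y : Y) : ℝ :=
  ∑ x, μ (x, y)

/-- Conditional probability of label `y` given features `x`. -/
noncomputable def condY {X Y : Type*} [Fintype Y] (μ : X × Y → ℝ) (x : X) (y : Y) : ℝ :=
  μ (x, y) / margX μ x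

/-- Pushforward of a distribution on a finite set under a map. -/
noncomputable def pushforward {Z : Type*} [Fintype Z] [DecidableEq Z]
    (μ : Z → ℝ) (h : Z → Z) (z : Z) : ℝ :=
  ∑ w, if h w = z then μ w else 0

/-- A classifier `m` is `ε`-suboptimal on `X'` under `P`: for every `x ∈ X'` there is a
distribution `q` on labels at total-variation distance at most `ε` from `P(·∣x)` such that
`m x` maximizes `q`. -/
def Suboptimal {X Y : Type*} [Fintype Y] (m : X → Y) (ε : ℝ) (X' : Set X)
    (P : X × Y → ℝ) : Prop :=
  ∀ x ∈ X', ∃ q : Y → ℝ, (∀ y, 0 ≤ q y) ∧ (∑ y, q y = 1) ∧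
    (1 / 2) * (∑ y, |q y - condY P x y|) ≤ ε ∧ ∀ y, q y ≤ q (m x)

/-- Mass that the pushforward of the `X`-marginal of `μ` under `h` gives to `x`. -/
noncomputable def pushMass {X Y : Type*} [Fintype X] [Fintype Y] [DecidableEq X]
    (μ : X × Y → ℝ) (h : X → X) (x : X) : ℝ :=
  ∑ w, if h w = x then margX μ w else 0

section FeatureLabel

variable {X Y : Type*} [Fintype X] [Fintype Y] [DecidableEq X]

lemma pushforward_featureLabel [DecidableEq Y] (μ : X × Y → ℝ) (h : X → X) (t : Y)
    (x : X) (y : Y) :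
    pushforward μ (fun w => (h w.1, t)) (x, y) = if t = y then pushMass μ h x else 0 := by
  unfold pushforward pushMass margX
  rw [Fintype.sum_prod_type]
  by_cases hy : t = y
  · simp only [Prod.mk.injEq, hy, and_true, if_true]
    refine Finset.sum_congr rfl fun w _ => ?_
    split_ifs <;> simp
  · simp [hy]

lemma margX_pushforward_featureLabel [DecidableEq Y] (μ : X × Y → ℝ) (h : X → X) (t : Y)
    (x : X) :
    margX (pushforward μ (fun w => (h w.1, t))) x = pushMass μ h x := by
  simp [margX, pushforward_featureLabel]

lemma pushMass_nonneg {μ : X × Y → ℝ} (hμ : ∀ x, 0 < margX μ x) (h : X → X) (x : X) :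
    0 ≤ pushMass μ h x := by
  refine Finset.sum_nonneg fun w _ => ?_
  split_ifs
  exacts [(hμ w).le, le_rfl]

lemma pushMass_pos {μ : X × Y → ℝ} (hμ : ∀ x, 0 < margX μ x) {h : X → X} {x : X}
    (hx : x ∈ Finset.univ.image h) : 0 < pushMass μ h x := by
  obtain ⟨w, -, rfl⟩ := Finset.mem_image.mp hx
  refine Finset.sum_pos' (fun v _ => ?_) ⟨w, Finset.mem_univ _, by simpa using hμ w⟩
  split_ifs
  exacts [(hμ v).le, le_rfl]

lemma sum_image_pushMass_mul (μ : X × Y → ℝ) (h : X → X) (f : X → ℝ) :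
    ∑ x ∈ Finset.univ.image h, pushMass μ h x * f x = ∑ w, margX μ w * f (h w) := by
  simp only [pushMass, Finset.sum_mul]
  rw [Finset.sum_comm]
  refine Finset.sum_congr rfl fun w _ => ?_
  rw [Finset.sum_eq_single (h w)]
  · simp
  · intro x _ hx
    simp [hx.symm]
  · simp

end FeatureLabel

lemma sum_margX {X Y : Type*} [Fintype X] [Fintype Y] {μ : X × Y → ℝ} (hμ : IsDist μ) :
    ∑ x, margX μ x = 1 := by
  rw [← hμ.2, Fintype.sum_prod_type]
  rfl

/-- A total-variation perturbation of size `ε` changes the difference of two probabilities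
by at most `2 * ε`, so a label beaten by `m x` has conditional probability at most `2 * ε`
above that of `m x`. -/
lemma Suboptimal.sub_le {X Y : Type*} [Fintype Y] {m : X → Y} {ε : ℝ} {X' : Set X}
    {P : X × Y → ℝ} (h : Suboptimal m ε X' P) {x : X} (hx : x ∈ X') (hP : 0 < margX P x)
    {y : Y} (hy : m x ≠ y) : P (x, y) - P (x, m x) ≤ 2 * ε * margX P x := by
  classical
  obtain ⟨q, -, -, hTV, hmax⟩ := h x hx
  have hpair : |q y - condY P x y| + |q (m x) - condY P x (m x)|
      ≤ ∑ y, |q y - condY P x y| := by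
    rw [← Finset.sum_pair (f := fun z => |q z - condY P x z|) hy.symm]
    exact Finset.sum_le_sum_of_subset_of_nonneg (Finset.subset_univ _)
      fun _ _ _ => abs_nonneg _
  have hcond : condY P x y - condY P x (m x) ≤ 2 * ε := by
    have h1 := neg_abs_le (q y - condY P x y)
    have h2 := le_abs_self (q (m x) - condY P x (m x))
    linarith [hmax y]
  rwa [condY, condY, ← sub_div, div_le_iff₀ hP] at hcond

/-- Egalitarian global success lower bound under the feature-label
strategy (Corollary 1, first bound). -/
theorem stmt4 {X Y : Type*} [Fintype X] [Fintype Y] [DecidableEq X] [DecidableEq Y]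
    [Nonempty X] [Nonempty Y]
    (hY : 2 ≤ Fintype.card Y)
    (P0 : X × Y → ℝ) (hP0 : IsDist P0) (hpos : ∀ x, 0 < margX P0 x)
    (M : ℕ) (hM : 1 ≤ M)
    (α : Fin M → ℝ) (hα : ∀ c, 0 < α c) (htot : ∑ i, α i ≤ 1)
    (g : Fin M → X → X) (ystar : Fin M → Y)
    (P : X × Y → ℝ)
    (hP : P = fun z => (1 - ∑ i, α i) * P0 z +
      ∑ j, α j * pushforward P0 (fun w => (g j w.1, ystar j)) z)
    (ε : ℝ) (hε0 : 0 ≤ ε) (hε : ε < 1 / 2)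
    (m : X → Y) (hsub : Suboptimal m ε Set.univ P)
    (ξc : Fin M → ℝ) (ξ : ℝ)
    (hξc : ∀ c, ∑ x' ∈ Finset.univ.image (g c), margX P0 x' ≤ ξc c)
    (hξ : ∀ c, ∀ j, j ≠ c →
      ∑ x' ∈ Finset.univ.image (g c),
        margX (pushforward P0 (fun w => (g j w.1, ystar j))) x' ≤ ξ)
    (Δ : Fin M → ℝ)
    (hΔ : ∀ c, Δ c = (Finset.univ.image (g c)).sup'
      (Finset.image_nonempty.mpr Finset.univ_nonempty)
      (fun x => (Finset.univ.sup' Finset.univ_nonempty (fun y => condY P0 x y))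
        - condY P0 x (ystar c)))
    (β : Fin M → ℝ)
    (hβ : ∀ c, β c = ∑ j ∈ Finset.univ.filter (fun j => j ≠ c ∧ ystar j = ystar c), α j) :
    1 - (Finset.univ.sup' ⟨⟨0, hM⟩, Finset.mem_univ _⟩ (fun c =>
        ξc c * ((Δ c + 2 * ε) / (1 - 2 * ε)) * ((1 - ∑ i, α i) / α c)
          + ξ * ((1 + 2 * ε) / (1 - 2 * ε)) * ((∑ i, α i - α c - β c) / α c)))
    ≤ Finset.univ.inf' ⟨⟨0, hM⟩, Finset.mem_univ _⟩ (fun c =>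
        ∑ x, margX P0 x * (if m (g c x) = ystar c then (1 : ℝ) else 0)) := by
  refine Finset.le_inf' _ _ fun c _ => ?_
  refine le_trans (sub_le_sub_left (Finset.le_sup' _ (Finset.mem_univ c)) 1) ?_
  simp only [margX_pushforward_featureLabel] at hξ
  set A := ∑ i, α i with hA
  set D := Finset.univ.filter (fun j => ystar j ≠ ystar c) with hD
  have hεpos : 0 < 1 - 2 * ε := by linarith
  have hmass : A - α c - β c = ∑ j ∈ D, α j := by
    have hsplit := Finset.sum_filter_add_sum_filter_not Finset.univ
      (fun j => ystar j = ystar c) α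
    have hself : ∑ j ∈ Finset.univ.filter (fun j => ystar j = ystar c), α j = α c + β c := by
      rw [hβ, ← Finset.add_sum_erase _ α (show c ∈ _ by simp)]
      congr 2
      ext j
      simp
    rw [hA, ← hsplit, hself]
    ring
  have hgap : ∀ x ∈ Finset.univ.image (g c), ∀ y,
      P0 (x, y) - P0 (x, ystar c) ≤ Δ c * margX P0 x := by
    intro x hx y
    have h1 := Finset.le_sup' (fun y => condY P0 x y) (Finset.mem_univ y)
    have h2 := Finset.le_sup' (fun x => (Finset.univ.sup' Finset.univ_nonempty
      (fun y => condY P0 x y)) - condY P0 x (ystar c)) hx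
    rw [← hΔ c] at h2
    have h3 : condY P0 x y - condY P0 x (ystar c) ≤ Δ c := by
      linarith
    rwa [condY, condY, ← sub_div, div_le_iff₀ (hpos x)] at h3
  have hΔ0 : 0 ≤ Δ c := by
    obtain ⟨x⟩ := ‹Nonempty X›
    have h1 := hgap (g c x) (Finset.mem_image_of_mem _ (Finset.mem_univ x)) (ystar c)
    rw [sub_self] at h1
    exact nonneg_of_mul_nonneg_left h1 (hpos _)
  have hPxy : ∀ x y, P (x, y) = (1 - A) * P0 (x, y)
      + ∑ j, if ystar j = y then α j * pushMass P0 (g j) x else 0 := by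
    intro x y
    simp [hP, pushforward_featureLabel]
  have hPX : ∀ x, margX P x = (1 - A) * margX P0 x + ∑ j, α j * pushMass P0 (g j) x := by
    intro x
    simp only [margX, hPxy, Finset.sum_add_distrib, ← Finset.mul_sum]
    rw [Finset.sum_comm]
    simp
  have hterm : ∀ j x, 0 ≤ α j * pushMass P0 (g j) x :=
    fun j x => mul_nonneg (hα j).le (pushMass_nonneg hpos _ _)
  have hpoint : ∀ x ∈ Finset.univ.image (g c),
      (1 - 2 * ε) * α c * (pushMass P0 (g c) x * if m x = ystar c then 0 else 1)
        ≤ (1 - A) * (Δ c + 2 * ε) * margX P0 x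
          + (1 + 2 * ε) * ∑ j ∈ D, α j * pushMass P0 (g j) x := by
    intro x hx
    have hDnn : 0 ≤ ∑ j ∈ D, α j * pushMass P0 (g j) x :=
      Finset.sum_nonneg fun j _ => hterm j x
    have hA0 : 0 ≤ 1 - A := by linarith
    split_ifs with hmx
    · have := (hpos x).le
      rw [mul_zero, mul_zero]
      positivity
    · have hc : α c * pushMass P0 (g c) x
          ≤ ∑ j ∈ Finset.univ.filter (fun j => ystar j = ystar c),
            α j * pushMass P0 (g j) x :=
        Finset.single_le_sum (f := fun j => α j * pushMass P0 (g j) x)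
          (fun j _ => hterm j x) (by simp)
      have hother : (∑ j, if ystar j = m x then α j * pushMass P0 (g j) x else 0)
          ≤ ∑ j ∈ D, α j * pushMass P0 (g j) x := by
        rw [← Finset.sum_filter]
        refine Finset.sum_le_sum_of_subset_of_nonneg (fun j hj => ?_) fun j _ _ => hterm j x
        rw [Finset.mem_filter] at hj
        simpa [hD, hj.2] using hmx
      have hsplit := Finset.sum_filter_add_sum_filter_not Finset.univ
        (fun j => ystar j = ystar c) (fun j => α j * pushMass P0 (g j) x)
      have hPpos : 0 < margX P x := by
        have h1 := mul_pos (hα c) (pushMass_pos hpos hx)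
        have h2 := mul_nonneg hA0 (hpos x).le
        rw [hPX, ← hsplit]
        linarith
      have hsubx := hsub.sub_le (Set.mem_univ x) hPpos hmx
      rw [hPX, hPxy, hPxy, ← hsplit, ← Finset.sum_filter] at hsubx
      have hgapx := mul_le_mul_of_nonneg_left (hgap x hx (m x)) hA0
      have hcε := mul_le_mul_of_nonneg_left hc hεpos.le
      rw [mul_one]
      linarith
  have hsum := Finset.sum_le_sum hpoint
  rw [← Finset.mul_sum, sum_image_pushMass_mul P0 (g c) (fun x => if m x = ystar c then 0 else 1),
    Finset.sum_add_distrib, ← Finset.mul_sum, ← Finset.mul_sum, Finset.sum_comm] at hsum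
  have hcross : ∑ j ∈ D, ∑ x ∈ Finset.univ.image (g c), α j * pushMass P0 (g j) x
      ≤ (∑ j ∈ D, α j) * ξ := by
    rw [Finset.sum_mul]
    refine Finset.sum_le_sum fun j hj => ?_
    rw [← Finset.mul_sum]
    refine mul_le_mul_of_nonneg_left (hξ c j ?_) (hα j).le
    rintro rfl
    simp [hD] at hj
  have hfail : ∑ x, margX P0 x * (if m (g c x) = ystar c then (0 : ℝ) else 1)
      = 1 - ∑ x, margX P0 x * (if m (g c x) = ystar c then (1 : ℝ) else 0) := by
    rw [eq_sub_iff_add_eq, ← Finset.sum_add_distrib]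
    refine Eq.trans ?_ (sum_margX hP0)
    refine Finset.sum_congr rfl fun x _ => ?_
    split_ifs <;> simp
  rw [hfail] at hsum
  have hbase := mul_le_mul_of_nonneg_left (hξc c)
    (mul_nonneg (by linarith : 0 ≤ 1 - A) (by linarith : 0 ≤ Δ c + 2 * ε))
  have hcrossε := mul_le_mul_of_nonneg_left hcross (by linarith : 0 ≤ 1 + 2 * ε)
  have hαc := hα c
  rw [hmass, sub_le_comm]
  have hform : ξc c * ((Δ c + 2 * ε) / (1 - 2 * ε)) * ((1 - A) / α c)
      + ξ * ((1 + 2 * ε) / (1 - 2 * ε)) * ((∑ j ∈ D, α j) / α c)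
      = ((1 - A) * (Δ c + 2 * ε) * ξc c + (1 + 2 * ε) * ((∑ j ∈ D, α j) * ξ))
        / ((1 - 2 * ε) * α c) := by
    field_simp
  rw [hform, le_div_iff₀ (mul_pos hεpos hαc)]
  linarith
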